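/- arXiv:1912.03892 — 3 statements merged into one kernel-verified Lean document; each statement's English description precedes it below -/
import Mathlib

section
/- Let R be a finite commutative ring, k ≥ 1, and let Ω ⊆ R^k satisfy 0 ∉ Ω and uΩ = Ω for every unit u of R. Let A be the 0/1 adjacency matrix of the Cayley graph Γ(Ω) on R^k. Then for every integer s > 1: Ω ∪ {0} is an s-sum set if and only if the graph Γ(Ω)^1 obtained by adding one loop at every vertex is an s-SWRG, i.e., there exist constants λ, μ, ν such that for all g, h ∈ R^k the (g,h) entry of (A + I)^s equals λ if g − h ∈ Ω, μ if g ≠ h and g − h ∉ Ω, and ν if g = h. -/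
/-- `Ω` is an `s`-sum set: there are constants `σ0, σ1` such that every nonzero `h`
can be written as a sum of `s` elements of `Ω` in exactly `σ0` ways if `h ∈ Ω` and
`σ1` ways otherwise. -/
def IsSumSet {V : Type*} [AddCommMonoid V] [DecidableEq V] (Ω : Finset V) (s : ℕ) : Prop :=
  ∃ σ0 σ1 : ℕ, ∀ h : V, h ≠ 0 →
    {x : Fin s → V | (∀ i, x i ∈ Ω) ∧ ∑ i, x i = h}.ncard = if h ∈ Ω then σ0 else σ1

/-- The 0/1 adjacency matrix of the Cayley graph `Γ(Ω)`: `g` and `h` are adjacent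
iff `g - h ∈ Ω`. -/
def cayleyAdj {V : Type*} [AddCommGroup V] [DecidableEq V] (Ω : Finset V) :
    Matrix V V ℕ := fun g h => if g - h ∈ Ω then 1 else 0

theorem ncard_sum_succ {V : Type*} [AddCommGroup V] [Fintype V] [DecidableEq V]
    (Ω : Finset V) (n : ℕ) (d : V) :
    {x : Fin (n + 1) → V | (∀ i, x i ∈ Ω) ∧ ∑ i, x i = d}.ncard =
      ∑ y : V, if y ∈ Ω then
        {x : Fin n → V | (∀ i, x i ∈ Ω) ∧ ∑ i, x i = d - y}.ncard else 0 := by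
  classical
  simp only [Set.ncard_eq_toFinset_card', Set.toFinset_ofPred, Finset.card_filter]
  rw [← (Fin.consEquiv fun _ => V).sum_comp, Fintype.sum_prod_type]
  refine Finset.sum_congr rfl fun y _ => ?_
  by_cases hy : y ∈ Ω <;>
    simp [Fin.consEquiv, Fin.forall_fin_succ, Fin.sum_univ_succ, hy, eq_sub_iff_add_eq']

/-- Entries of powers of the Cayley adjacency matrix count representations as sums. -/
theorem cayleyAdj_pow_apply {V : Type*} [AddCommGroup V] [Fintype V] [DecidableEq V]
    (Ω : Finset V) (n : ℕ) (g h : V) :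
    (cayleyAdj Ω ^ n) g h =
      {x : Fin n → V | (∀ i, x i ∈ Ω) ∧ ∑ i, x i = g - h}.ncard := by
  induction n generalizing g with
  | zero =>
    classical
    by_cases hgh : g = h
    · simp [hgh]
    · simp [hgh, eq_comm (a := (0 : V)), sub_eq_zero]
  | succ n ih =>
    rw [pow_succ', Matrix.mul_apply, ncard_sum_succ, ← (Equiv.subLeft g).sum_comp]
    refine Finset.sum_congr rfl fun y _ => ?_
    rw [ih]
    simp [cayleyAdj, sub_right_comm g y h]

theorem cayleyAdj_add_one {V : Type*} [AddCommGroup V] [DecidableEq V]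
    {Ω : Finset V} (h0 : (0 : V) ∉ Ω) : cayleyAdj Ω + 1 = cayleyAdj (insert 0 Ω) := by
  ext g h
  by_cases hgh : g = h
  · simp [cayleyAdj, hgh, h0]
  · simp [cayleyAdj, hgh, sub_eq_zero]


theorem stmt1 {R : Type*} [CommRing R] [Fintype R] [DecidableEq R]
    {k : ℕ} (hk : 1 ≤ k) (Ω : Finset (Fin k → R))
    (h0 : (0 : Fin k → R) ∉ Ω)
    (hunit : ∀ u : Rˣ, Ω.image (fun x => (u : R) • x) = Ω)
    (s : ℕ) (hs : 1 < s) :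
    IsSumSet (insert (0 : Fin k → R) Ω) s ↔
      ∃ lam mu nu : ℕ, ∀ g h : Fin k → R,
        (g - h ∈ Ω → ((cayleyAdj Ω + 1) ^ s) g h = lam) ∧
        (g ≠ h → g - h ∉ Ω → ((cayleyAdj Ω + 1) ^ s) g h = mu) ∧
        (g = h → ((cayleyAdj Ω + 1) ^ s) g h = nu) := by
  simp only [cayleyAdj_add_one h0, cayleyAdj_pow_apply]
  constructor
  · rintro ⟨σ0, σ1, H⟩
    refine ⟨σ0, σ1, {x : Fin s → Fin k → R |
      (∀ i, x i ∈ insert 0 Ω) ∧ ∑ i, x i = 0}.ncard, fun g h => ⟨fun hm => ?_, fun hne hm => ?_, fun he => ?_⟩⟩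
    · rw [H _ (ne_of_mem_of_not_mem hm h0), if_pos (Finset.mem_insert_of_mem hm)]
    · rw [H _ (sub_ne_zero.2 hne), if_neg (by simp [hm, sub_ne_zero.2 hne])]
    · rw [sub_eq_zero.2 he]
  · rintro ⟨lam, mu, nu, H⟩
    refine ⟨lam, mu, fun h hne => ?_⟩
    obtain ⟨h1, h2, -⟩ := H h 0
    rw [sub_zero] at h1 h2
    by_cases hm : h ∈ Ω
    · rw [if_pos (Finset.mem_insert_of_mem hm), h1 hm]
    · rw [if_neg (by simp [hm, hne]), h2 hne hm]
end

section
/- Under the three-weight hypothesis on Ω ⊆ ZMod(p^m)^k, let A be the 0/1 adjacency matrix of the Cayley graph Γ(Ω) on R^k = ZMod(p^m)^k, and let b be a non-negative integer. Then the graph Γ(Ω)^b obtained by adding b loops at every vertex is a 3-strongly walk-regular graph — i.e., there exist constants λ, μ, ν such that for all g, h ∈ R^k the (g,h) entry of (A + b·I)^3 equals λ if g − h ∈ Ω, μ if g ≠ h and g − h ∉ Ω, and ν if g = h — if and only if p·(w1 + w2 + w3) = 3·(b + n·(p−1)·p^(m−1)). -/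
-- The homogeneous weight on `ZMod (p^m)`.
open Classical in
noncomputable def hwt (p m : ℕ) (x : ZMod (p^m)) : ℕ :=
  if x = 0 then 0
  else if x ∈ Ideal.span {(p : ZMod (p^m))^(m-1)} then p^(m-1)
  else (p-1) * p^(m-2)

open Matrix in
/-- The nontrivial characters of `ZMod N ^ k` in the first variable of the dot product sum to zero. -/
theorem sum_stdAddChar_dotProduct {N k : ℕ} [NeZero N] {h : Fin k → ZMod N} (hh : h ≠ 0) :
    ∑ x : Fin k → ZMod N, ZMod.stdAddChar (x ⬝ᵥ h) = 0 := by
  obtain ⟨i, hi⟩ := Function.ne_iff.mp hh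
  have hne : ZMod.stdAddChar (Pi.single i 1 ⬝ᵥ h) ≠ 1 := by
    rw [single_one_dotProduct]
    intro h1
    exact hi (ZMod.injective_stdAddChar (h1.trans (AddChar.map_zero_eq_one _).symm))
  have hshift : ∑ x : Fin k → ZMod N, ZMod.stdAddChar (x ⬝ᵥ h) =
      ZMod.stdAddChar (Pi.single i 1 ⬝ᵥ h) * ∑ x : Fin k → ZMod N, ZMod.stdAddChar (x ⬝ᵥ h) := by
    rw [Finset.mul_sum, ← Equiv.sum_comp (Equiv.addLeft (Pi.single i (1 : ZMod N)))]
    simp [add_dotProduct, AddChar.map_add_eq_mul]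
  by_contra h0
  exact hne (mul_right_cancel₀ h0 (by rw [one_mul]; exact hshift.symm))

theorem filter_isUnit_eq_map {M : Type*} [Monoid M] [Fintype M] [Fintype Mˣ]
    [DecidablePred (IsUnit : M → Prop)] :
    (Finset.univ.filter fun a : M => IsUnit a) =
      Finset.univ.map ⟨Units.val, Units.val_injective⟩ := by
  ext a
  rw [Finset.mem_filter_univ, Finset.mem_map]
  simp only [Finset.mem_univ, true_and]
  rfl

section PrimePower

variable {p m : ℕ} [Fact p.Prime]

theorem isUnit_zmod_prime_pow_iff (hm : 1 ≤ m) (a : ZMod (p ^ m)) :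
    IsUnit a ↔ ¬ (p : ZMod (p ^ m)) ∣ a := by
  have hp : p.Prime := Fact.out
  obtain ⟨a, rfl⟩ := ZMod.natCast_zmod_surjective a
  rw [ZMod.isUnit_iff_coprime, Nat.coprime_pow_right_iff hm, Nat.coprime_comm,
    hp.coprime_iff_not_dvd, not_iff_not]
  constructor
  · exact fun h => Nat.cast_dvd_cast h
  · rintro ⟨c, hc⟩
    obtain ⟨c, rfl⟩ := ZMod.natCast_zmod_surjective c
    rw [← Nat.cast_mul, ZMod.natCast_eq_natCast_iff] at hc
    exact ((hc.of_dvd (dvd_pow_self p (by omega))).dvd_iff dvd_rfl).mpr (dvd_mul_right p c)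

theorem mem_span_prime_pow_pred_iff (hm : 1 ≤ m) (r : ZMod (p ^ m)) :
    r ∈ Ideal.span {(p : ZMod (p ^ m)) ^ (m - 1)} ↔ (p : ZMod (p ^ m)) * r = 0 := by
  have hp : p.Prime := Fact.out
  have hpm : p ^ m = p * p ^ (m - 1) := by rw [← pow_succ', Nat.sub_add_cancel hm]
  rw [Ideal.mem_span_singleton]
  constructor
  · rintro ⟨c, rfl⟩
    rw [← mul_assoc, ← pow_succ', Nat.sub_add_cancel hm, ← Nat.cast_pow, ZMod.natCast_self,
      zero_mul]
  · obtain ⟨r, rfl⟩ := ZMod.natCast_zmod_surjective r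
    intro h
    rw [← Nat.cast_mul, ZMod.natCast_eq_zero_iff] at h
    have h' : p * p ^ (m - 1) ∣ p * r := hpm ▸ h
    exact_mod_cast Nat.cast_dvd_cast (α := ZMod (p ^ m)) (Nat.dvd_of_mul_dvd_mul_left hp.pos h')

open Classical in
/-- The sum of an additive character over the maximal ideal of `ZMod (p ^ m)`. -/
theorem sum_nonunits_stdAddChar (hm : 1 ≤ m) (r : ZMod (p ^ m)) :
    ∑ a : ZMod (p ^ m) with ¬ IsUnit a, ZMod.stdAddChar (a * r) =
      if (p : ZMod (p ^ m)) * r = 0 then (p : ℂ) ^ (m - 1) else 0 := by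
  have hp : p.Prime := Fact.out
  simp only [isUnit_zmod_prime_pow_iff hm, not_not]
  split_ifs with hr
  · have hcard : (Finset.univ.filter fun a : ZMod (p ^ m) => (p : ZMod (p ^ m)) ∣ a).card =
        p ^ (m - 1) := by
      have h1 := Finset.card_filter_add_card_filter_not
        (s := (Finset.univ : Finset (ZMod (p ^ m)))) (fun a => IsUnit a)
      have h2 : (Finset.univ.filter fun a : ZMod (p ^ m) => IsUnit a).card =
          p ^ (m - 1) * (p - 1) := by
        rw [← Nat.totient_prime_pow hp hm, ← ZMod.card_units_eq_totient, ← Finset.card_univ,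
          filter_isUnit_eq_map, Finset.card_map]
      simp only [isUnit_zmod_prime_pow_iff hm, not_not] at h1 h2
      rw [h2, Finset.card_univ, ZMod.card] at h1
      have h3 : p ^ m = p ^ (m - 1) * (p - 1) + p ^ (m - 1) := by
        rw [← Nat.mul_succ, Nat.succ_eq_add_one, Nat.sub_add_cancel hp.one_le, ← pow_succ,
          Nat.sub_add_cancel hm]
      omega
    rw [Finset.sum_congr rfl (g := fun _ => (1 : ℂ))]
    · simp [hcard]
    · intro a ha
      obtain ⟨c, rfl⟩ := (Finset.mem_filter.mp ha).2
      rw [mul_right_comm, hr, zero_mul, AddChar.map_zero_eq_one]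
  · have hne : ZMod.stdAddChar ((p : ZMod (p ^ m)) * r) ≠ 1 := fun h1 =>
      hr (ZMod.injective_stdAddChar (h1.trans (AddChar.map_zero_eq_one _).symm))
    have hshift : ∑ a : ZMod (p ^ m) with (p : ZMod (p ^ m)) ∣ a, ZMod.stdAddChar (a * r) =
        ZMod.stdAddChar ((p : ZMod (p ^ m)) * r) *
          ∑ a : ZMod (p ^ m) with (p : ZMod (p ^ m)) ∣ a, ZMod.stdAddChar (a * r) := by
      rw [Finset.mul_sum]
      refine (Finset.sum_equiv (Equiv.addLeft (p : ZMod (p ^ m))) (fun a => ?_)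
        (fun a _ => ?_)).symm
      · simp
      · simp [add_mul, AddChar.map_add_eq_mul]
    by_contra h0
    exact hne (mul_right_cancel₀ h0 (by rw [one_mul]; exact hshift.symm))

/-- The homogeneous weight as a normalized sum of characters over the units. -/
theorem mul_hwt_eq (hm : 2 ≤ m) (r : ZMod (p ^ m)) :
    (p : ℂ) * hwt p m r =
      ((p - 1) * p ^ (m - 1) : ℕ) - ∑ u : (ZMod (p ^ m))ˣ,
        ZMod.stdAddChar ((u : ZMod (p ^ m)) * r) := by
  classical
  have hp : p.Prime := Fact.out
  have hunits : ∑ u : (ZMod (p ^ m))ˣ, ZMod.stdAddChar ((u : ZMod (p ^ m)) * r) =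
      ∑ a : ZMod (p ^ m) with IsUnit a, ZMod.stdAddChar (a * r) := by
    rw [filter_isUnit_eq_map, Finset.sum_map]
    rfl
  have hall : ∑ a : ZMod (p ^ m), ZMod.stdAddChar (a * r) = if r = 0 then (p : ℂ) ^ m else 0 := by
    have := AddChar.sum_mulShift r (ZMod.isPrimitive_stdAddChar (p ^ m))
    rw [this]
    split_ifs <;> simp [ZMod.card]
  have hsplit := Finset.sum_filter_add_sum_filter_not Finset.univ (fun a : ZMod (p ^ m) => IsUnit a)
    fun a => ZMod.stdAddChar (a * r)
  rw [hall, sum_nonunits_stdAddChar (by omega)] at hsplit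
  rw [hunits, eq_sub_of_add_eq hsplit]
  obtain ⟨j, rfl⟩ := Nat.exists_eq_add_of_le' hm
  have hp1 : ((p - 1 : ℕ) : ℂ) = p - 1 := by rw [Nat.cast_sub hp.one_le, Nat.cast_one]
  unfold hwt
  simp only [mem_span_prime_pow_pred_iff (show 1 ≤ j + 2 by omega)]
  simp only [show j + 2 - 1 = j + 1 by omega, Nat.add_sub_cancel]
  by_cases h0 : r = 0
  · simp only [h0, mul_zero, if_true]
    push_cast [hp1]
    ring
  · by_cases h1 : (p : ZMod (p ^ (j + 2))) * r = 0
    · simp only [h0, h1, if_true, if_false]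
      push_cast [hp1]
      ring
    · simp only [h0, h1, if_false]
      push_cast [hp1]
      ring

open Matrix in
/-- The homogeneous weight of the codeword determined by `x`, in terms of the eigenvalue of the
Cayley graph of `Ω` at the character `x`. -/
theorem mul_sum_hwt_eq (hm : 2 ≤ m) {k : ℕ} {Ω : Finset (Fin k → ZMod (p ^ m))}
    (hunit : ∀ u : (ZMod (p ^ m))ˣ, Ω.image (fun x => (u : ZMod (p ^ m)) • x) = Ω)
    (x : Fin k → ZMod (p ^ m)) :
    (p : ℂ) * (∑ ω ∈ Ω, hwt p m (x ⬝ᵥ ω) : ℕ) =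
      ((p - 1) * p ^ (m - 1) : ℕ) * (Ω.card - ∑ ω ∈ Ω, ZMod.stdAddChar (x ⬝ᵥ ω)) := by
  have hp : p.Prime := Fact.out
  have hsum (u : (ZMod (p ^ m))ˣ) : ∑ ω ∈ Ω, ZMod.stdAddChar ((u : ZMod (p ^ m)) * (x ⬝ᵥ ω)) =
      ∑ ω ∈ Ω, ZMod.stdAddChar (x ⬝ᵥ ω) := by
    conv_rhs => rw [← hunit u]
    rw [Finset.sum_image]
    · simp [dotProduct_smul]
    · intro a _ b _ hab
      exact (Units.isUnit u).smul_left_cancel.mp hab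
  have hcard : Fintype.card (ZMod (p ^ m))ˣ = (p - 1) * p ^ (m - 1) := by
    rw [ZMod.card_units_eq_totient, Nat.totient_prime_pow hp (by omega), mul_comm]
  rw [Nat.cast_sum, Finset.mul_sum, Finset.sum_congr rfl fun ω _ => mul_hwt_eq hm (x ⬝ᵥ ω),
    Finset.sum_sub_distrib, Finset.sum_comm, Finset.sum_congr rfl fun u _ => hsum u]
  simp only [Finset.sum_const, Finset.card_univ, hcard, nsmul_eq_mul]
  ring

end PrimePower

section Spectrum

open Matrix

variable {N k : ℕ} [NeZero N]

theorem cayleyAdj_add_loops_map_apply {V : Type*} [AddCommGroup V] [DecidableEq V] (Ω : Finset V)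
    (b : ℕ) (g h : V) :
    (cayleyAdj Ω + b • 1 : Matrix V V ℕ).map (Nat.cast : ℕ → ℂ) g h =
      (if g - h ∈ Ω then 1 else 0) + if g = h then (b : ℂ) else 0 := by
  simp only [Matrix.map_apply, Matrix.add_apply, Matrix.smul_apply, Matrix.one_apply, cayleyAdj]
  split_ifs <;> simp

/-- Characters are eigenvectors of the looped Cayley graph. -/
theorem cayleyAdj_add_loops_mulVec (Ω : Finset (Fin k → ZMod N)) (b : ℕ) (x : Fin k → ZMod N) :
    (cayleyAdj Ω + b • 1 : Matrix (Fin k → ZMod N) (Fin k → ZMod N) ℕ).map (Nat.cast : ℕ → ℂ) *ᵥ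
        (fun h => ZMod.stdAddChar (-(x ⬝ᵥ h))) =
      ((∑ ω ∈ Ω, ZMod.stdAddChar (x ⬝ᵥ ω)) + b) • fun h => ZMod.stdAddChar (-(x ⬝ᵥ h)) := by
  ext g
  simp only [mulVec, dotProduct, cayleyAdj_add_loops_map_apply, Pi.smul_apply, smul_eq_mul, add_mul,
    Finset.sum_add_distrib, ite_mul, one_mul, zero_mul, Finset.sum_ite_eq, Finset.mem_univ, if_true]
  congr 1
  rw [← Equiv.sum_comp (Equiv.subLeft g), Finset.sum_mul]
  simp only [Equiv.subLeft_apply, sub_sub_cancel]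
  rw [Finset.sum_ite_mem, Finset.univ_inter]
  refine Finset.sum_congr rfl fun ω _ => ?_
  rw [← AddChar.map_add_eq_mul]
  congr 1
  simp only [Pi.sub_apply, mul_sub, Finset.sum_sub_distrib]
  ring

theorem pow_mulVec_eq_smul {V : Type*} [Fintype V] [DecidableEq V] {B : Matrix V V ℂ} {v : V → ℂ}
    {t : ℂ} (h : B *ᵥ v = t • v) (j : ℕ) : (B ^ j) *ᵥ v = t ^ j • v := by
  induction j with
  | zero => simp
  | succ j ih => rw [pow_succ, ← mulVec_mulVec, h, mulVec_smul, ih, smul_smul, pow_succ']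

/-- A matrix that kills all nontrivial characters has constant rows. -/
theorem apply_eq_of_mulVec_stdAddChar_eq_zero {M : Matrix (Fin k → ZMod N) (Fin k → ZMod N) ℂ}
    (hM : ∀ x : Fin k → ZMod N, x ≠ 0 → M *ᵥ (fun h => ZMod.stdAddChar (-(x ⬝ᵥ h))) = 0)
    (g h : Fin k → ZMod N) :
    (N : ℂ) ^ k * M g h = (M *ᵥ fun _ => 1) g := by
  have key : ∑ x : Fin k → ZMod N, ZMod.stdAddChar (x ⬝ᵥ h) *
      (M *ᵥ (fun h => ZMod.stdAddChar (-(x ⬝ᵥ h)))) g = (M *ᵥ fun _ => 1) g := by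
    rw [Finset.sum_eq_single 0]
    · simp
    · intro x _ hx
      simp [hM x hx]
    · simp
  rw [← key]
  simp only [mulVec, dotProduct_comm (M g)]
  simp only [dotProduct.eq_1 _ (M g), Finset.mul_sum]
  rw [Finset.sum_comm, Finset.sum_eq_single h]
  · simp [← mul_assoc, ← AddChar.map_add_eq_mul]
  · intro h' _ hh
    simp only [← mul_assoc, ← AddChar.map_add_eq_mul]
    rw [← Finset.sum_mul]
    have := sum_stdAddChar_dotProduct (sub_ne_zero.mpr hh.symm)
    simp only [dotProduct_sub, sub_eq_add_neg (_ ⬝ᵥ h)] at this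
    rw [this, zero_mul]
  · simp

/-- The looped Cayley graph is 3-strongly walk-regular iff the cube is an affine function on the
nontrivial part of its spectrum. -/
theorem cube_apply_const_iff {Ω : Finset (Fin k → ZMod N)} (h0 : (0 : Fin k → ZMod N) ∉ Ω)
    (b : ℕ) :
    (∃ lam mu nu : ℕ, ∀ g h : Fin k → ZMod N,
        (g - h ∈ Ω → ((cayleyAdj Ω + b • 1 : Matrix (Fin k → ZMod N) (Fin k → ZMod N) ℕ) ^ 3) g h =
          lam) ∧
        (g ≠ h → g - h ∉ Ω →
          ((cayleyAdj Ω + b • 1 : Matrix (Fin k → ZMod N) (Fin k → ZMod N) ℕ) ^ 3) g h = mu) ∧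
        (g = h → ((cayleyAdj Ω + b • 1 : Matrix (Fin k → ZMod N) (Fin k → ZMod N) ℕ) ^ 3) g h =
          nu)) ↔
      ∃ α β : ℂ, ∀ x : Fin k → ZMod N, x ≠ 0 →
        ((∑ ω ∈ Ω, ZMod.stdAddChar (x ⬝ᵥ ω)) + b) ^ 3 =
          α * ((∑ ω ∈ Ω, ZMod.stdAddChar (x ⬝ᵥ ω)) + b) + β := by
  set A : Matrix (Fin k → ZMod N) (Fin k → ZMod N) ℕ := cayleyAdj Ω + b • 1 with hA
  set B : Matrix (Fin k → ZMod N) (Fin k → ZMod N) ℂ := A.map (Nat.cast : ℕ → ℂ) with hB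
  have hB3 (g h) : (B ^ 3) g h = (((A ^ 3) g h : ℕ) : ℂ) := by
    have := map_pow (Nat.castRingHom ℂ).mapMatrix A 3
    exact (congrFun (congrFun this g) h).symm
  have hBe (g h) : B g h = (if g - h ∈ Ω then 1 else 0) + if g = h then (b : ℂ) else 0 :=
    cayleyAdj_add_loops_map_apply Ω b g h
  have hBv (x : Fin k → ZMod N) := cayleyAdj_add_loops_mulVec Ω b x
  rw [← hA, ← hB] at hBv
  constructor
  · rintro ⟨lam, mu, nu, H⟩
    refine ⟨lam - mu, nu - mu - (lam - mu) * b, fun x hx => ?_⟩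
    have hmat : B ^ 3 = ((lam : ℂ) - mu) • B + ((nu : ℂ) - mu - (lam - mu) * b) • 1 +
        (mu : ℂ) • Matrix.of fun _ _ => 1 := by
      ext g h
      rw [hB3]
      simp only [Matrix.add_apply, Matrix.smul_apply, hBe, Matrix.one_apply, Matrix.of_apply,
        smul_eq_mul]
      obtain ⟨H1, H2, H3⟩ := H g h
      by_cases hg : g = h
      · have hnot : g - h ∉ Ω := by rw [hg, sub_self]; exact h0
        rw [H3 hg, if_neg hnot, if_pos hg, if_pos hg]
        ring
      · by_cases hgh : g - h ∈ Ω
        · rw [H1 hgh, if_pos hgh, if_neg hg, if_neg hg]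
          ring
        · rw [H2 hg hgh, if_neg hgh, if_neg hg, if_neg hg]
          ring
    have hJ : (Matrix.of fun _ _ => 1 : Matrix (Fin k → ZMod N) (Fin k → ZMod N) ℂ) *ᵥ
        (fun h : Fin k → ZMod N => ZMod.stdAddChar (-(x ⬝ᵥ h))) = 0 := by
      ext g
      have := sum_stdAddChar_dotProduct (neg_ne_zero.mpr hx)
      simp only [dotProduct_comm _ (-x), neg_dotProduct] at this
      rw [mulVec, dotProduct]
      simpa using this
    have hv := pow_mulVec_eq_smul (hBv x) 3
    rw [hmat, add_mulVec, add_mulVec, smul_mulVec, smul_mulVec, smul_mulVec, hJ, hBv x,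
      one_mulVec] at hv
    have := congrFun hv 0
    simp only [Pi.add_apply, Pi.smul_apply, smul_eq_mul, dotProduct_zero, neg_zero,
      AddChar.map_zero_eq_one, Pi.zero_apply] at this
    linear_combination -this
  · rintro ⟨α, β, H⟩
    have hN : (N : ℂ) ^ k ≠ 0 := pow_ne_zero _ (Nat.cast_ne_zero.mpr (NeZero.ne N))
    have hconst : ∃ c : ℂ, ∀ g h,
        (B ^ 3 - α • B - β • 1 : Matrix (Fin k → ZMod N) (Fin k → ZMod N) ℂ) g h = c := by
      set t : ℂ := Ω.card + b with ht
      refine ⟨((N : ℂ) ^ k)⁻¹ * (t ^ 3 - α * t - β), fun g h => ?_⟩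
      have hker (x : Fin k → ZMod N) (hx : x ≠ 0) : (B ^ 3 - α • B - β • 1) *ᵥ
          (fun h => ZMod.stdAddChar (-(x ⬝ᵥ h))) = 0 := by
        rw [sub_mulVec, sub_mulVec, smul_mulVec, smul_mulVec, one_mulVec,
          pow_mulVec_eq_smul (hBv x) 3, hBv x, H x hx]
        ext g
        simp only [Pi.sub_apply, Pi.smul_apply, smul_eq_mul, Pi.zero_apply]
        ring
      rw [eq_inv_mul_iff_mul_eq₀ hN, apply_eq_of_mulVec_stdAddChar_eq_zero hker]
      have hone : B *ᵥ (fun _ => 1) = t • fun _ => 1 := by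
        simpa [ht] using hBv 0
      rw [sub_mulVec, sub_mulVec, smul_mulVec, smul_mulVec, one_mulVec,
        pow_mulVec_eq_smul hone 3, hone]
      simp
    obtain ⟨c, hc⟩ := hconst
    have hval (g h) : (((A ^ 3) g h : ℕ) : ℂ) = α * B g h + β * (if g = h then 1 else 0) + c := by
      rw [← hB3, ← hc g h]
      simp only [Matrix.sub_apply, Matrix.smul_apply, Matrix.one_apply, smul_eq_mul]
      ring
    have hex (P : (Fin k → ZMod N) → (Fin k → ZMod N) → Prop) (z : ℂ)
        (hz : ∀ g h, P g h → (((A ^ 3) g h : ℕ) : ℂ) = z) :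
        ∃ l : ℕ, ∀ g h, P g h → (A ^ 3) g h = l := by
      by_cases hP : ∃ g h, P g h
      · obtain ⟨g, h, hgh⟩ := hP
        refine ⟨(A ^ 3) g h, fun g' h' hgh' => ?_⟩
        exact_mod_cast (hz g' h' hgh').trans (hz g h hgh).symm
      · exact ⟨0, fun g h hgh => absurd ⟨g, h, hgh⟩ hP⟩
    obtain ⟨lam, hlam⟩ := hex (fun g h => g - h ∈ Ω) (α + c) fun g h hgh => by
      have hg : g ≠ h := by
        rintro rfl
        exact h0 (by rwa [sub_self] at hgh)
      rw [hval, hBe, if_pos hgh, if_neg hg, if_neg hg]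
      ring
    obtain ⟨mu, hmu⟩ := hex (fun g h => g ≠ h ∧ g - h ∉ Ω) c fun g h hgh => by
      rw [hval, hBe, if_neg hgh.2, if_neg hgh.1, if_neg hgh.1]
      ring
    obtain ⟨nu, hnu⟩ := hex (fun g h => g = h) (α * b + β + c) fun g h hgh => by
      have hnot : g - h ∉ Ω := by rw [hgh, sub_self]; exact h0
      rw [hval, hBe, if_neg hnot, if_pos hgh, if_pos hgh]
      ring
    exact ⟨lam, mu, nu, fun g h =>
      ⟨hlam g h, fun h1 h2 => hmu g h ⟨h1, h2⟩, hnu g h⟩⟩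

end Spectrum

/-- Three distinct numbers are roots of a common cubic `t ^ 3 - α * t - β` iff they sum to zero. -/
theorem exists_depressed_cubic_iff {F : Type*} [Field F] {a b c : F} (hab : a ≠ b) (hac : a ≠ c)
    (hbc : b ≠ c) :
    (∃ α β : F, a ^ 3 = α * a + β ∧ b ^ 3 = α * b + β ∧ c ^ 3 = α * c + β) ↔ a + b + c = 0 := by
  constructor
  · rintro ⟨α, β, ha, hb, hc⟩
    have h1 : a ^ 2 + a * b + b ^ 2 = α :=
      mul_left_cancel₀ (sub_ne_zero.mpr hab) (by linear_combination ha - hb)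
    have h2 : a ^ 2 + a * c + c ^ 2 = α :=
      mul_left_cancel₀ (sub_ne_zero.mpr hac) (by linear_combination ha - hc)
    exact mul_left_cancel₀ (sub_ne_zero.mpr hbc) (by linear_combination h1 - h2)
  · intro h
    refine ⟨-(a * b + a * c + b * c), a * b * c, ?_, ?_, ?_⟩
    · linear_combination a ^ 2 * h
    · linear_combination b ^ 2 * h
    · linear_combination c ^ 2 * h

theorem stmt3 (p m : ℕ) [Fact p.Prime] (hm : 2 ≤ m)
    {k : ℕ} (hk : 1 ≤ k) (Ω : Finset (Fin k → ZMod (p^m)))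
    (h0 : (0 : Fin k → ZMod (p^m)) ∉ Ω)
    (hunit : ∀ u : (ZMod (p^m))ˣ, Ω.image (fun x => (u : ZMod (p^m)) • x) = Ω)
    (hreg : ∀ ω ∈ Ω, ∃ i, IsUnit (ω i))
    (hspan : Submodule.span (ZMod (p^m)) (Ω : Set (Fin k → ZMod (p^m))) = ⊤)
    (n : ℕ) (hn : Ω.card = n * (p - 1) * p^(m-1))
    (w1 w2 w3 : ℕ) (hw1 : 0 < w1) (h12 : w1 < w2) (h23 : w2 < w3)
    -- three-weight hypothesis: the homogeneous weight `W x` of the dual codeword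
    -- determined by a nonzero `x`, i.e. `(∑ ω ∈ Ω, hwt (x·ω)) / ((p-1)p^(m-1))`,
    -- takes exactly the values `w1, w2, w3`
    (hW : (fun x : Fin k → ZMod (p^m) => ∑ ω ∈ Ω, hwt p m (∑ i, x i * ω i)) ''
            {x | x ≠ 0}
          = {w1 * ((p - 1) * p^(m-1)), w2 * ((p - 1) * p^(m-1)),
             w3 * ((p - 1) * p^(m-1))})
    (b : ℕ) :
    -- `Γ(Ω)^b`, the Cayley graph with `b` loops added at every vertex, is a 3-SWRG
    (∃ lam mu nu : ℕ, ∀ g h : Fin k → ZMod (p^m),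
        (g - h ∈ Ω → (((cayleyAdj Ω + b • 1 : Matrix (Fin k → ZMod (p^m)) (Fin k → ZMod (p^m)) ℕ)) ^ 3) g h = lam) ∧
        (g ≠ h → g - h ∉ Ω → (((cayleyAdj Ω + b • 1 : Matrix (Fin k → ZMod (p^m)) (Fin k → ZMod (p^m)) ℕ)) ^ 3) g h = mu) ∧
        (g = h → (((cayleyAdj Ω + b • 1 : Matrix (Fin k → ZMod (p^m)) (Fin k → ZMod (p^m)) ℕ)) ^ 3) g h = nu))
      ↔ p * (w1 + w2 + w3) = 3 * (b + n * (p - 1) * p^(m-1)) := by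
  have hp : p.Prime := Fact.out
  have hφ : (((p - 1) * p ^ (m - 1) : ℕ) : ℂ) ≠ 0 :=
    Nat.cast_ne_zero.mpr (Nat.mul_ne_zero (Nat.sub_ne_zero_of_lt hp.one_lt)
      (pow_ne_zero _ hp.ne_zero))
  have hpC : (p : ℂ) ≠ 0 := Nat.cast_ne_zero.mpr hp.ne_zero
  set θ : (Fin k → ZMod (p ^ m)) → ℂ := fun x =>
    (∑ ω ∈ Ω, ZMod.stdAddChar (x ⬝ᵥ ω)) + (b : ℂ) with hθ
  set t : ℕ → ℂ := fun w => (Ω.card : ℂ) - p * w + b with ht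
  have hθt (x : Fin k → ZMod (p ^ m)) (w : ℕ)
      (hx : ∑ ω ∈ Ω, hwt p m (∑ i, x i * ω i) = w * ((p - 1) * p ^ (m - 1))) : θ x = t w := by
    have h := mul_sum_hwt_eq hm hunit x
    simp only [dotProduct] at h
    rw [hx, Nat.cast_mul] at h
    have h' : (p : ℂ) * w = Ω.card - ∑ ω ∈ Ω, ZMod.stdAddChar (∑ i, x i * ω i) :=
      mul_left_cancel₀ hφ (by linear_combination h)
    simp only [hθ, ht, dotProduct]
    linear_combination h'
  have hspec (P : ℂ → Prop) : (∀ x, x ≠ 0 → P (θ x)) ↔ P (t w1) ∧ P (t w2) ∧ P (t w3) := by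
    constructor
    · intro H
      have hmem (w : ℕ) (hw : w * ((p - 1) * p ^ (m - 1)) ∈
          ({w1 * ((p - 1) * p ^ (m - 1)), w2 * ((p - 1) * p ^ (m - 1)),
            w3 * ((p - 1) * p ^ (m - 1))} : Set ℕ)) : P (t w) := by
        rw [← hW] at hw
        obtain ⟨x, hx, hxw⟩ := hw
        exact hθt x w hxw ▸ H x hx
      exact ⟨hmem w1 (by simp), hmem w2 (by simp), hmem w3 (by simp)⟩
    · rintro ⟨H1, H2, H3⟩ x hx
      have hmem := hW.subset (Set.mem_image_of_mem _ hx)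
      rcases hmem with h | h | h
      · exact hθt x w1 h ▸ H1
      · exact hθt x w2 h ▸ H2
      · exact hθt x w3 h ▸ H3
  have hinj : Function.Injective t := fun v w h => by
    have : (p : ℂ) * v = p * w := by
      simp only [ht] at h
      linear_combination -h
    exact_mod_cast mul_left_cancel₀ hpC this
  rw [cube_apply_const_iff h0 b]
  simp only [← hn]
  calc (∃ α β : ℂ, ∀ x, x ≠ 0 → θ x ^ 3 = α * θ x + β)
      ↔ t w1 + t w2 + t w3 = 0 := by
        rw [← exists_depressed_cubic_iff (hinj.ne h12.ne) (hinj.ne (h12.trans h23).ne)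
          (hinj.ne h23.ne)]
        exact exists_congr fun α => exists_congr fun β => hspec fun z => z ^ 3 = α * z + β
    _ ↔ p * (w1 + w2 + w3) = 3 * (b + Ω.card) := by
        rw [← Nat.cast_inj (R := ℂ)]
        push_cast
        simp only [ht]
        constructor <;> intro h <;> linear_combination -h
end

section
/- Let C ⊆ (ZMod 4)^n be a Z4-linear three-weight code: the set of Lee weights of nonzero codewords of C is exactly {w1, w2, w3} with w1 < w2 < w3. Assume that every nonzero vector of the dual code C⊥ has Lee weight at least 3, and that w1 + w2 + w3 = 3n. Then n is even. -/
/-- The Lee (= homogeneous) weight on `ZMod 4`: wt 0 = 0, wt 1 = wt 3 = 1, wt 2 = 2. -/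
def leeWt (x : ZMod 4) : ℕ := if x = 0 then 0 else if x = 2 then 2 else 1

/-- The Lee weight of a vector, extended coordinatewise. -/
def leeWtVec {n : ℕ} (v : Fin n → ZMod 4) : ℕ := ∑ i, leeWt (v i)

/-- The dual code of a linear code `C` over a commutative ring, with respect to the
standard inner product. -/
def dualCode {R : Type*} [CommRing R] {n : ℕ} (C : Submodule R (Fin n → R)) :
    Submodule R (Fin n → R) where
  carrier := {x | ∀ c ∈ C, ∑ i, x i * c i = 0}
  add_mem' := by
    intro a b ha hb c hc
    simp only [Set.mem_setOf_eq] at *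
    simp [Pi.add_apply, add_mul, Finset.sum_add_distrib, ha c hc, hb c hc]
  zero_mem' := by
    intro c hc
    simp
  smul_mem' := by
    intro r a ha c hc
    simp only [Set.mem_setOf_eq] at *
    simp [Pi.smul_apply, smul_eq_mul, mul_assoc, ← Finset.mul_sum, ha c hc]

/-- The real part of the character `v ↦ I ^ v` of `ZMod 4`. -/
def reChar (v : ZMod 4) : ℤ := 1 - leeWt v

lemma reChar_zero : reChar 0 = 1 := by decide

lemma reChar_add_two (v : ZMod 4) : reChar (v + 2) = -reChar v := by
  revert v; decide

lemma two_mul_reChar_mul (u v : ZMod 4) :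
    2 * (reChar u * reChar v) = reChar (u + v) + reChar (u - v) := by
  revert u v; decide

lemma reChar_two_mul_natCast (k : ℕ) : reChar (2 * (k : ZMod 4)) = (-1) ^ k := by
  induction k with
  | zero => decide
  | succ k ih =>
    rw [Nat.cast_succ, mul_add, mul_one, reChar_add_two, ih, pow_succ, mul_neg_one]

lemma leeWt_add_le (u v : ZMod 4) : leeWt (u + v) ≤ leeWt u + leeWt v := by
  revert u v; decide

lemma leeWtVec_add_le {n : ℕ} (u v : Fin n → ZMod 4) :
    leeWtVec (u + v) ≤ leeWtVec u + leeWtVec v := by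
  unfold leeWtVec
  rw [← Finset.sum_add_distrib]
  exact Finset.sum_le_sum fun i _ => leeWt_add_le _ _

lemma leeWtVec_single {n : ℕ} (i : Fin n) (a : ZMod 4) :
    leeWtVec (Pi.single i a) = leeWt a := by
  unfold leeWtVec
  rw [Finset.sum_eq_single i]
  · simp
  · intro j _ hj
    simp [Pi.single_eq_of_ne hj, leeWt]
  · simp

lemma leeWtVec_eq_zero {n : ℕ} {v : Fin n → ZMod 4} (h : leeWtVec v = 0) : v = 0 := by
  have key : ∀ a : ZMod 4, leeWt a = 0 → a = 0 := by decide
  unfold leeWtVec at h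
  rw [Finset.sum_eq_zero_iff] at h
  ext1 i
  exact key _ (h i (Finset.mem_univ i))

lemma sum_reChar {n : ℕ} (v : Fin n → ZMod 4) :
    ∑ i, reChar (v i) = n - (leeWtVec v : ℤ) := by
  simp [reChar, leeWtVec]

lemma reChar_two_mul_sum {n : ℕ} (v : Fin n → ZMod 4) :
    reChar (2 * ∑ i, v i) = (-1) ^ leeWtVec v := by
  have key : ∀ a : ZMod 4, 2 * a = 2 * (leeWt a : ZMod 4) := by decide
  rw [← reChar_two_mul_natCast]
  congr 1
  unfold leeWtVec
  push_cast
  rw [Finset.mul_sum, Finset.mul_sum]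
  exact Finset.sum_congr rfl fun i _ => key _

lemma even_leeWtVec_two_smul {n : ℕ} (v : Fin n → ZMod 4) :
    Even (leeWtVec ((2 : ZMod 4) • v)) := by
  have key : ∀ a : ZMod 4, Even (leeWt (2 * a)) := by decide
  unfold leeWtVec
  exact Finset.even_sum _ fun i _ => key _

lemma single_add_single_notMem_dualCode {n : ℕ} {C : Submodule (ZMod 4) (Fin n → ZMod 4)}
    (hdual : ∀ d ∈ dualCode C, d ≠ 0 → 3 ≤ leeWtVec d) {i j : Fin n} {a b : ZMod 4}
    (hab : leeWt a + leeWt b ≤ 2) (hne : (Pi.single i a + Pi.single j b : Fin n → ZMod 4) ≠ 0) :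
    (Pi.single i a + Pi.single j b : Fin n → ZMod 4) ∉ dualCode C := by
  intro h
  have h₁ := hdual _ h hne
  have h₂ := leeWtVec_add_le (Pi.single i a : Fin n → ZMod 4) (Pi.single j b)
  rw [leeWtVec_single, leeWtVec_single] at h₂
  lia

lemma single_notMem_dualCode {n : ℕ} {C : Submodule (ZMod 4) (Fin n → ZMod 4)}
    (hdual : ∀ d ∈ dualCode C, d ≠ 0 → 3 ≤ leeWtVec d) (j : Fin n) {a : ZMod 4} (ha : a ≠ 0) :
    (Pi.single j a : Fin n → ZMod 4) ∉ dualCode C := by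
  have key : ∀ a : ZMod 4, leeWt a < 3 := by decide
  intro h
  have h₁ := hdual _ h (by simpa using ha)
  rw [leeWtVec_single] at h₁
  exact absurd (key a) (by lia)

lemma sum_single_mul {n : ℕ} (j : Fin n) (a : ZMod 4) (c : Fin n → ZMod 4) :
    ∑ i, (Pi.single j a : Fin n → ZMod 4) i * c i = a * c j := by
  rw [Finset.sum_eq_single j]
  · simp
  · intro i _ hi
    simp [Pi.single_eq_of_ne hi]
  · simp

section CharacterSums

variable {n : ℕ} (C : Submodule (ZMod 4) (Fin n → ZMod 4)) [Fintype C]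

/-- Orthogonality relation: a character that is nontrivial on `C` sums to zero over `C`. -/
lemma sum_reChar_eq_zero {d : Fin n → ZMod 4} (hd : d ∉ dualCode C) :
    ∑ c : C, reChar (∑ i, d i * c.1 i) = 0 := by
  have key : ∀ a : ZMod 4, a ≠ 0 → a = 2 ∨ 2 * a = 2 := by decide
  obtain ⟨c₀, hc₀⟩ : ∃ c₀ : C, ∑ i, d i * c₀.1 i = 2 := by
    have : ∃ c ∈ C, ∑ i, d i * c i ≠ 0 := by
      by_contra! h
      exact hd h
    obtain ⟨c, hc, hne⟩ := this
    rcases key _ hne with h | h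
    · exact ⟨⟨c, hc⟩, h⟩
    · refine ⟨⟨(2 : ZMod 4) • c, C.smul_mem _ hc⟩, ?_⟩
      rw [Finset.mul_sum] at h
      refine Eq.trans (Finset.sum_congr rfl fun i _ => ?_) h
      simp only [Pi.smul_apply, smul_eq_mul]
      ring
  have h := Equiv.sum_comp (Equiv.addRight c₀) fun c : C => reChar (∑ i, d i * c.1 i)
  simp only [Equiv.coe_addRight, Submodule.coe_add, Pi.add_apply, mul_add,
    Finset.sum_add_distrib, hc₀, reChar_add_two, Finset.sum_neg_distrib] at h
  lia

variable {C}

lemma sum_reChar_coord (hdual : ∀ d ∈ dualCode C, d ≠ 0 → 3 ≤ leeWtVec d) (j : Fin n) :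
    ∑ c : C, reChar (c.1 j) = 0 := by
  simpa [sum_single_mul] using
    sum_reChar_eq_zero C (single_notMem_dualCode hdual j (a := 1) (by decide))

lemma two_mul_sum_reChar_sq (hdual : ∀ d ∈ dualCode C, d ≠ 0 → 3 ≤ leeWtVec d) (j : Fin n) :
    2 * ∑ c : C, reChar (c.1 j) * reChar (c.1 j) = Fintype.card C := by
  have h := sum_reChar_eq_zero C (single_notMem_dualCode hdual j (a := 2) (by decide))
  simp only [sum_single_mul] at h
  simp only [Finset.mul_sum, two_mul_reChar_mul, sub_self, reChar_zero,
    Finset.sum_add_distrib, ← two_mul (_ : ZMod 4), h]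
  simp

lemma sum_reChar_mul_reChar (hdual : ∀ d ∈ dualCode C, d ≠ 0 → 3 ≤ leeWtVec d) {i j : Fin n}
    (hij : i ≠ j) : ∑ c : C, reChar (c.1 i) * reChar (c.1 j) = 0 := by
  have hne : ∀ b : ZMod 4, (Pi.single i 1 + Pi.single j b : Fin n → ZMod 4) ≠ 0 := by
    intro b h
    have h₁ : (1 : ZMod 4) = 0 := by simpa [Pi.single_eq_of_ne hij] using congrFun h i
    exact absurd h₁ (by decide)
  have h₁ := sum_reChar_eq_zero C
    (single_add_single_notMem_dualCode hdual (b := 1) (by decide) (hne 1))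
  have h₂ := sum_reChar_eq_zero C
    (single_add_single_notMem_dualCode hdual (b := -1) (by decide) (hne (-1)))
  simp only [Pi.add_apply, add_mul, Finset.sum_add_distrib, sum_single_mul, one_mul,
    neg_mul, ← sub_eq_add_neg] at h₁ h₂
  have h₃ : 2 * ∑ c : C, reChar (c.1 i) * reChar (c.1 j) = 0 := by
    simp only [Finset.mul_sum, two_mul_reChar_mul, Finset.sum_add_distrib, h₁, h₂, add_zero]
  lia

lemma sum_parity_mul_reChar (hdual : ∀ d ∈ dualCode C, d ≠ 0 → 3 ≤ leeWtVec d) (j : Fin n) :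
    ∑ c : C, (-1) ^ leeWtVec c.1 * reChar (c.1 j) = 0 := by
  have hmem : ∀ b : ZMod 4, 2 * b = 2 →
      ((fun _ => 2) + Pi.single j b : Fin n → ZMod 4) ∉ dualCode C := by
    intro b hb h
    refine single_notMem_dualCode hdual j (a := 2) (by decide) ?_
    convert (dualCode C).smul_mem 2 h using 1
    ext1 i
    have h4 : (2 : ZMod 4) * 2 = 0 := by decide
    by_cases hi : i = j
    · subst hi
      simp [mul_add, hb, h4]
    · simp [Pi.single_eq_of_ne hi, h4]
  have h₁ := sum_reChar_eq_zero C (hmem 1 (by decide))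
  have h₂ := sum_reChar_eq_zero C (hmem (-1) (by decide))
  simp only [Pi.add_apply, add_mul, Finset.sum_add_distrib, sum_single_mul, one_mul,
    neg_mul, ← sub_eq_add_neg, ← Finset.mul_sum] at h₁ h₂
  have h₃ : 2 * ∑ c : C, (-1) ^ leeWtVec c.1 * reChar (c.1 j) = 0 := by
    simp only [Finset.mul_sum, ← reChar_two_mul_sum, two_mul_reChar_mul]
    simp only [← Finset.mul_sum, Finset.sum_add_distrib, h₁, h₂, add_zero]
  lia

lemma sum_parity {c₀ : Fin n → ZMod 4} (hc₀ : c₀ ∈ C) (hodd : Odd (leeWtVec c₀)) :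
    ∑ c : C, (-1 : ℤ) ^ leeWtVec c.1 = 0 := by
  have hmem : (fun _ => 2 : Fin n → ZMod 4) ∉ dualCode C := by
    intro h
    have h₁ := h c₀ hc₀
    rw [← Finset.mul_sum] at h₁
    have h₂ := reChar_two_mul_sum c₀
    rw [h₁, hodd.neg_one_pow, reChar_zero] at h₂
    lia
  have h := sum_reChar_eq_zero C hmem
  simpa only [← Finset.mul_sum, reChar_two_mul_sum] using h

/-- The half eigenvalue `n - wt c` of the coset graph attached to the codeword `c`. -/
def leeDefect (c : Fin n → ZMod 4) : ℤ := n - leeWtVec c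

lemma sum_leeDefect (hdual : ∀ d ∈ dualCode C, d ≠ 0 → 3 ≤ leeWtVec d) :
    ∑ c : C, leeDefect c.1 = 0 := by
  simp only [leeDefect, ← sum_reChar]
  rw [Finset.sum_comm]
  exact Finset.sum_eq_zero fun j _ => sum_reChar_coord hdual j

lemma sum_parity_mul_leeDefect (hdual : ∀ d ∈ dualCode C, d ≠ 0 → 3 ≤ leeWtVec d) :
    ∑ c : C, (-1) ^ leeWtVec c.1 * leeDefect c.1 = 0 := by
  simp only [leeDefect, ← sum_reChar, Finset.mul_sum]
  rw [Finset.sum_comm]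
  exact Finset.sum_eq_zero fun j _ => sum_parity_mul_reChar hdual j

lemma two_mul_sum_leeDefect_mul_reChar
    (hdual : ∀ d ∈ dualCode C, d ≠ 0 → 3 ≤ leeWtVec d) (j : Fin n) :
    2 * ∑ c : C, leeDefect c.1 * reChar (c.1 j) = Fintype.card C := by
  simp only [leeDefect, ← sum_reChar, Finset.sum_mul]
  rw [Finset.sum_comm, Finset.sum_eq_single j]
  · exact two_mul_sum_reChar_sq hdual j
  · intro i _ hij
    exact sum_reChar_mul_reChar hdual hij
  · simp

lemma two_mul_sum_leeDefect_sq (hdual : ∀ d ∈ dualCode C, d ≠ 0 → 3 ≤ leeWtVec d) :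
    2 * ∑ c : C, leeDefect c.1 ^ 2 = n * Fintype.card C := by
  have h : ∀ c : C, leeDefect c.1 ^ 2 = ∑ j, leeDefect c.1 * reChar (c.1 j) := by
    intro c
    rw [← Finset.mul_sum, sum_reChar, sq, leeDefect]
  simp only [h]
  rw [Finset.sum_comm, Finset.mul_sum]
  simp [two_mul_sum_leeDefect_mul_reChar hdual]

lemma card_dvd_four_pow : Fintype.card C ∣ 4 ^ n := by
  have h := C.toAddSubgroup.card_addSubgroup_dvd_card
  rw [Nat.card_eq_fintype_card (α := Fin n → ZMod 4), Fintype.card_fun, ZMod.card,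
    Fintype.card_fin] at h
  rwa [← Nat.card_eq_fintype_card]

end CharacterSums

/-- A code of odd length with dual distance at least 3 cannot have nonzero weights `p` odd and
`q`, `r` even with mean `n`. -/
lemma false_of_odd_even_even {n : ℕ} (hn : Odd n) (C : Submodule (ZMod 4) (Fin n → ZMod 4))
    (hdual : ∀ d ∈ dualCode C, d ≠ 0 → 3 ≤ leeWtVec d) {p q r : ℕ}
    (hp : Odd p) (hq : Even q) (hr : Even r) (hsum : p + q + r = 3 * n)
    (hwt : ∀ c ∈ C, c ≠ 0 → leeWtVec c = p ∨ leeWtVec c = q ∨ leeWtVec c = r)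
    (hp' : ∃ c ∈ C, c ≠ 0 ∧ leeWtVec c = p) (hq' : ∃ c ∈ C, c ≠ 0 ∧ leeWtVec c = q)
    (hr' : ∃ c ∈ C, c ≠ 0 ∧ leeWtVec c = r) : False := by
  classical
  have : Fintype C := Fintype.ofFinite C
  have hn₀ : 0 < n := hn.pos
  have hwt₀ : leeWtVec (0 : Fin n → ZMod 4) = 0 := by simp [leeWtVec, leeWt]
  have hdef₀ : leeDefect (0 : Fin n → ZMod 4) = n := by simp [leeDefect, hwt₀]
  have hM : (0 : ℤ) < Fintype.card C := by exact_mod_cast Fintype.card_pos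
  obtain ⟨cp, hcp, -, hcpw⟩ := hp'
  have hpar := sum_parity hcp (hcpw ▸ hp)
  have hpn : p = n := by
    have h : ∑ c : C, (1 - (-1) ^ leeWtVec c.1) * leeDefect c.1 =
        ∑ c : C, (1 - (-1) ^ leeWtVec c.1) * ((n : ℤ) - p) := by
      refine Finset.sum_congr rfl fun c _ => ?_
      by_cases hc : c = 0
      · simp [hc, hwt₀]
      · rcases hwt c.1 c.2 (by simpa using hc) with h | h | h
        · rw [leeDefect, h]
        · simp [h, hq.neg_one_pow]
        · simp [h, hr.neg_one_pow]
    rw [← Finset.sum_mul, Finset.sum_sub_distrib, hpar] at h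
    simp only [sub_mul, one_mul, Finset.sum_sub_distrib, sum_leeDefect hdual,
      sum_parity_mul_leeDefect hdual] at h
    simp at h
    lia
  subst hpn
  obtain ⟨β, hβ⟩ : ∃ β : ℤ, β = (p : ℤ) - q := ⟨_, rfl⟩
  have hcases : ∀ c : C, c ≠ 0 →
      (leeDefect c.1 = 0 ∧ (-1 : ℤ) ^ leeWtVec c.1 = -1) ∨
      ((leeDefect c.1 = β ∨ leeDefect c.1 = -β) ∧ (-1 : ℤ) ^ leeWtVec c.1 = 1) := by
    intro c hc
    rcases hwt c.1 c.2 (by simpa using hc) with h | h | h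
    · exact Or.inl ⟨by simp [leeDefect, h], by rw [h, hp.neg_one_pow]⟩
    · exact Or.inr ⟨Or.inl (by rw [leeDefect, h, hβ]), by rw [h, hq.neg_one_pow]⟩
    · exact Or.inr ⟨Or.inr (by rw [leeDefect, h]; lia), by rw [h, hr.neg_one_pow]⟩
  have hsplit : ∀ f : C → ℤ, ∑ c, f c = f 0 + ∑ c ∈ Finset.univ.erase 0, f c := fun f =>
    (Finset.add_sum_erase _ f (Finset.mem_univ 0)).symm
  have hdvd : ∀ c : C, c ≠ 0 → β ∣ leeDefect c.1 := by
    intro c hc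
    rcases hcases c hc with ⟨h, -⟩ | ⟨h | h, -⟩ <;> simp [h]
  have hβM : β ∣ Fintype.card C := by
    have h₁ := sum_leeDefect hdual
    rw [← two_mul_sum_leeDefect_mul_reChar hdual ⟨0, hn₀⟩, hsplit]
    rw [hsplit] at h₁
    have hd₁ : β ∣ ∑ c ∈ (Finset.univ : Finset C).erase 0, leeDefect c.1 :=
      Finset.dvd_sum fun c hc => hdvd c (Finset.ne_of_mem_erase hc)
    have hd₂ : β ∣ ∑ c ∈ (Finset.univ : Finset C).erase 0,
        leeDefect c.1 * reChar (c.1 ⟨0, hn₀⟩) :=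
      Finset.dvd_sum fun c hc => (hdvd c (Finset.ne_of_mem_erase hc)).mul_right _
    rw [eq_neg_of_add_eq_zero_right h₁, dvd_neg] at hd₁
    refine Dvd.dvd.mul_left (dvd_add ?_ hd₂) _
    exact hd₁.mul_right _
  have hβ1 : β = 1 ∨ β = -1 := by
    have hodd : Odd β := by
      rw [hβ]
      exact Odd.sub_even (by exact_mod_cast hn) (by exact_mod_cast hq)
    have h4 : β ∣ 2 ^ (2 * p) := by
      rw [pow_mul]
      exact hβM.trans (by exact_mod_cast card_dvd_four_pow)
    have hcop : IsCoprime β (2 ^ (2 * p)) := by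
      obtain ⟨k, hk⟩ := hodd
      exact IsCoprime.pow_right ⟨1, -k, by rw [hk]; ring⟩
    exact Int.isUnit_iff.mp (hcop.isUnit_of_dvd' dvd_rfl h4)
  have hcount : ∑ c : C, (1 + (-1 : ℤ) ^ leeWtVec c.1) = Fintype.card C := by
    rw [Finset.sum_add_distrib, hpar]
    simp
  have hmoment : (p : ℤ) * Fintype.card C = 2 * p ^ 2 + (Fintype.card C - 2) := by
    have h : ∑ c ∈ (Finset.univ : Finset C).erase 0, 2 * leeDefect c.1 ^ 2 =
        ∑ c ∈ (Finset.univ : Finset C).erase 0, (1 + (-1 : ℤ) ^ leeWtVec c.1) := by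
      refine Finset.sum_congr rfl fun c hc => ?_
      rcases hcases c (Finset.ne_of_mem_erase hc) with ⟨h, h'⟩ | ⟨h | h, h'⟩ <;>
        rcases hβ1 with hb | hb <;> rw [h, h'] <;> simp [hb]
    have h₁ := two_mul_sum_leeDefect_sq hdual
    rw [Finset.mul_sum, hsplit, h] at h₁
    rw [hsplit] at hcount
    simp only [Submodule.coe_zero, hdef₀, hwt₀, pow_zero] at h₁ hcount
    lia
  have hminus : ∃ c ∈ C, c ≠ 0 ∧ leeDefect c = 1 := by
    rcases hβ1 with hb | hb
    · obtain ⟨c, hc, hc₀, hw⟩ := hq'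
      exact ⟨c, hc, hc₀, by rw [leeDefect, hw]; lia⟩
    · obtain ⟨c, hc, hc₀, hw⟩ := hr'
      exact ⟨c, hc, hc₀, by rw [leeDefect, hw]; lia⟩
  obtain ⟨c, hc, hc₀, hw⟩ := hminus
  have hfactor : ((p : ℤ) - 1) * (Fintype.card C - 2 * (p + 1)) = 0 := by
    linear_combination hmoment
  rcases mul_eq_zero.mp hfactor with h | h
  · refine hc₀ (leeWtVec_eq_zero ?_)
    rw [leeDefect] at hw
    lia
  · have hc₁ : (⟨c, hc⟩ : C) ≠ 0 := by simpa using hc₀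
    have hnonneg : ∀ c ∈ (Finset.univ : Finset C).erase 0,
        0 ≤ 2 * leeDefect c.1 + (1 + (-1 : ℤ) ^ leeWtVec c.1) := by
      intro c hc
      rcases hcases c (Finset.ne_of_mem_erase hc) with ⟨h, h'⟩ | ⟨h | h, h'⟩ <;>
        rw [h, h'] <;> lia
    have hle := Finset.single_le_sum hnonneg (Finset.mem_erase.mpr ⟨hc₁, Finset.mem_univ _⟩)
    have htot : ∑ c : C, (2 * leeDefect c.1 + (1 + (-1 : ℤ) ^ leeWtVec c.1)) =
        Fintype.card C := by
      rw [Finset.sum_add_distrib, ← Finset.mul_sum, sum_leeDefect hdual, hcount]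
      lia
    rw [hsplit] at htot
    simp only [Submodule.coe_zero, hdef₀, hwt₀, pow_zero] at htot
    rcases hcases ⟨c, hc⟩ hc₁ with ⟨h₁, -⟩ | ⟨-, h₁⟩
    · simp only at h₁
      lia
    · simp only [hw] at hle h₁
      lia

/-- A projective (dual distance ≥ 3) three-Lee-weight Z4-linear code with
`w1 + w2 + w3 = 3n` has even length. -/
theorem stmt18 {n : ℕ} (C : Submodule (ZMod 4) (Fin n → ZMod 4))
    (w1 w2 w3 : ℕ) (h12 : w1 < w2) (h23 : w2 < w3)
    (hwts : {w : ℕ | ∃ c ∈ C, c ≠ 0 ∧ leeWtVec c = w} = {w1, w2, w3})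
    (hdual : ∀ d ∈ dualCode C, d ≠ 0 → 3 ≤ leeWtVec d)
    (hsum : w1 + w2 + w3 = 3 * n) :
    Even n := by
  by_contra hev
  have hn : Odd n := Nat.not_even_iff_odd.mp hev
  have hmem : ∀ w, (∃ c ∈ C, c ≠ 0 ∧ leeWtVec c = w) ↔ w = w1 ∨ w = w2 ∨ w = w3 := by
    intro w
    simpa using Set.ext_iff.mp hwts w
  have h1 := (hmem w1).mpr (by simp)
  have h2 := (hmem w2).mpr (by simp)
  have h3 := (hmem w3).mpr (by simp)
  have hwt : ∀ c ∈ C, c ≠ 0 → leeWtVec c = w1 ∨ leeWtVec c = w2 ∨ leeWtVec c = w3 :=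
    fun c hc hc₀ => (hmem _).mp ⟨c, hc, hc₀, rfl⟩
  have heven : Even w1 ∨ Even w2 ∨ Even w3 := by
    have hd := single_notMem_dualCode hdual ⟨0, hn.pos⟩ (a := 2) (by decide)
    obtain ⟨c, hc, hne⟩ : ∃ c ∈ C, 2 * c ⟨0, hn.pos⟩ ≠ 0 := by
      by_contra! h
      exact hd fun c hc => by rw [sum_single_mul, h c hc]
    have hw := hwt _ (C.smul_mem 2 hc) fun h => hne (congrFun h ⟨0, hn.pos⟩)
    have he := even_leeWtVec_two_smul c
    rcases hw with h | h | h <;> rw [h] at he <;> simp [he]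
  have hodd : Odd (w1 + w2 + w3) := hsum ▸ Odd.mul (by decide) hn
  rcases Nat.even_or_odd w1 with e1 | o1 <;> rcases Nat.even_or_odd w2 with e2 | o2 <;>
    rcases Nat.even_or_odd w3 with e3 | o3
  · grind
  · exact false_of_odd_even_even hn C hdual o3 e1 e2 (by lia)
      (fun c hc hc₀ => by have := hwt c hc hc₀; tauto) h3 h1 h2
  · exact false_of_odd_even_even hn C hdual o2 e1 e3 (by lia)
      (fun c hc hc₀ => by have := hwt c hc hc₀; tauto) h2 h1 h3
  · grind
  · exact false_of_odd_even_even hn C hdual o1 e2 e3 (by lia) hwt h1 h2 h3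
  · grind
  · grind
  · grind
end
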